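/- arXiv:1011.0313 — 6 statements merged into one kernel-verified Lean document; each statement's English description precedes it below -/
import Mathlib

section
/- Let p be a prime, G a finite abelian p-group (written additively), and F : G^ℤ → G^ℤ a group endomorphism of the configuration space that commutes with the shift σ (where σ(r)_n = r_{n−1}) and is local, i.e. there is a finite set I ⊆ ℤ such that F(r)_0 depends only on the restriction of r to I. Fix an initial state ξ ∈ G, a finite set of colors C, an extra blank color b ∉ C, and a coloring 𝔠 : G → C ∪ {b} with 𝔠(0) = b. Then there exists a positive integer m such that for every color c₀ ∈ C there is a compact set K_{c₀} ⊆ ℝ² with: the extended Hausdorff distance between P_{p^{mn}}(c₀) and K_{c₀} tends to 0 as n → ∞. -/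
open Filter

namespace AbCA

/-- Configurations on the plane. -/
abbrev Cfg (G : Type) := ℤ × ℤ → G

abbrev LP := AddMonoidAlgebra ℤ (ℤ × ℤ)

noncomputable section

def shiftHom (G : Type) [AddCommGroup G] : Multiplicative (ℤ × ℤ) →* Module.End ℤ (Cfg G) where
  toFun w := LinearMap.funLeft ℤ G (fun v => v - w.toAdd)
  map_one' := by
    ext y v; simp [LinearMap.funLeft_apply]
  map_mul' a b := by
    refine LinearMap.ext fun y => funext fun v => ?_
    simp only [LinearMap.funLeft_apply, Module.End.mul_apply, toAdd_mul]
    congr 1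
    abel

def rho (G : Type) [AddCommGroup G] : LP →ₐ[ℤ] Module.End ℤ (Cfg G) :=
  AddMonoidAlgebra.lift ℤ (Module.End ℤ (Cfg G)) (ℤ × ℤ) (shiftHom G)

variable {G : Type} [AddCommGroup G]

lemma rho_single (w : ℤ × ℤ) (n : ℤ) (y : Cfg G) (v : ℤ × ℤ) :
    rho G (AddMonoidAlgebra.single w n) y v = n • y (v - w) := by
  simp [rho, shiftHom, LinearMap.funLeft_apply]

def Box (L : ℤ) (y : Cfg G) : Prop := ∀ v, y v ≠ 0 → |v.1| ≤ L ∧ |v.2| ≤ L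

lemma Box.mono {L L' : ℤ} (h : L ≤ L') {y : Cfg G} (hy : Box L y) : Box L' y :=
  fun v hv => ⟨(hy v hv).1.trans h, (hy v hv).2.trans h⟩

lemma Box.add {L : ℤ} {y z : Cfg G} (hy : Box L y) (hz : Box L z) : Box L (y + z) := by
  intro v hv
  by_cases h : y v = 0
  · refine hz v fun h' => hv ?_
    simp [h, h']
  · exact hy v h

lemma exists_box_rho (s : LP) : ∃ D : ℤ, 0 ≤ D ∧ ∀ (L : ℤ) (y : Cfg G), Box L y →
    Box (L + D) (rho G s y) := by
  induction s using AddMonoidAlgebra.induction_linear with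
  | zero => exact ⟨0, le_rfl, fun L y _ v hv => by simp at hv⟩
  | add f g hf hg =>
    obtain ⟨D1, h1, hf⟩ := hf
    obtain ⟨D2, h2, hg⟩ := hg
    refine ⟨D1 + D2, by omega, fun L y hy => ?_⟩
    rw [map_add, LinearMap.add_apply]
    exact ((hf L y hy).mono (by omega)).add ((hg L y hy).mono (by omega))
  | single w n =>
    refine ⟨|w.1| + |w.2|, by positivity, fun L y hy v hv => ?_⟩
    rw [rho_single] at hv
    have := hy (v - w) (fun h => hv (by simp [h]))
    simp only [Prod.fst_sub, Prod.snd_sub] at this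
    grind

/-- Supported in the half plane `j ≥ n`. -/
def Half (n : ℤ) (y : Cfg G) : Prop := ∀ v : ℤ × ℤ, v.2 < n → y v = 0

def emb : ℤ →+ ℤ × ℤ := AddMonoidHom.inl ℤ ℤ

def tt : LP := AddMonoidAlgebra.single (0, 1) 1

def embR : AddMonoidAlgebra ℤ ℤ →+* LP := AddMonoidAlgebra.mapDomainRingHom ℤ emb

lemma embR_single (i n : ℤ) : embR (AddMonoidAlgebra.single i n) =
    AddMonoidAlgebra.single (i, 0) n := by
  simp only [embR, AddMonoidAlgebra.mapDomainRingHom_apply, AddMonoidAlgebra.mapDomain_single]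
  rfl

def Theta : Polynomial (AddMonoidAlgebra ℤ ℤ) →+* LP := Polynomial.eval₂RingHom embR tt

lemma half_rho_embR (a : AddMonoidAlgebra ℤ ℤ) (n : ℤ) (y : Cfg G) (hy : Half n y) :
    Half n (rho G (embR a) y) := by
  induction a using AddMonoidAlgebra.induction_linear with
  | zero => intro v _; simp
  | add f g hf hg =>
    intro v hv
    simp [hf v hv, hg v hv]
  | single w k =>
    intro v hv
    rw [embR_single, rho_single, hy _ (by simpa using hv), smul_zero]

lemma half_tt (n : ℤ) (y : Cfg G) (hy : Half n y) : Half (n + 1) (rho G tt y) := by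
  intro v hv
  rw [tt, rho_single, hy _ (by simp; omega), smul_zero]

lemma Half.mono {n m : ℤ} (h : m ≤ n) {y : Cfg G} (hy : Half n y) : Half m y :=
  fun v hv => hy v (by omega)

lemma half_Theta (B : Polynomial (AddMonoidAlgebra ℤ ℤ)) (n : ℤ) (y : Cfg G) (hy : Half n y) :
    Half n (rho G (Theta B) y) := by
  induction B using Polynomial.induction_on generalizing y with
  | C a => simpa [Theta] using half_rho_embR a n y hy
  | add f g hf hg =>
    intro v hv
    simp [hf y hy v hv, hg y hy v hv]
  | monomial k a ih =>
    have : Theta (Polynomial.C a * Polynomial.X ^ (k+1)) =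
      Theta (Polynomial.C a * Polynomial.X ^ k) * tt := by
      rw [pow_succ, ← mul_assoc, map_mul]; congr 1; simp [Theta]
    rw [this, map_mul, Module.End.mul_apply]
    exact ih _ ((half_tt n y hy).mono (by omega))

lemma inj_of_eval (q : Polynomial (AddMonoidAlgebra ℤ ℤ)) (hq : q.eval 0 = 1)
    (y z : Cfg G) (hy : Half 0 y) (hz : Half 0 z) (h : rho G (Theta q) y = rho G (Theta q) z) :
    y = z := by
  have hX : Polynomial.X ∣ q - 1 := by
    rw [Polynomial.X_dvd_iff, Polynomial.coeff_zero_eq_eval_zero]; simp [hq]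
  obtain ⟨B, hB⟩ := hX
  have hq' : Theta q = 1 + tt * Theta B := by
    have : q = 1 + Polynomial.X * B := by rw [← hB]; ring
    rw [this, map_add, map_mul, map_one]; congr 2; simp [Theta]
  have h0 : rho G (Theta q) (y - z) = 0 := by rw [map_sub, h, sub_self]
  have key : ∀ n : ℕ, Half (n : ℤ) (y - z) := by
    intro n
    induction n with
    | zero =>
      intro v hv
      simp [hy v hv, hz v hv]
    | succ n ih =>
      have h1 := half_tt _ _ (half_Theta B _ _ ih)
      rw [hq', map_add, map_one, LinearMap.add_apply, map_mul, Module.End.mul_apply] at h0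
      have h2 : (y - z) = - rho G tt (rho G (Theta B) (y - z)) := eq_neg_of_add_eq_zero_left h0
      intro v hv
      rw [h2, Pi.neg_apply, h1 v (by push_cast at hv; exact hv), neg_zero]
  funext v
  have := key (v.2 + 1).toNat v (by omega)
  simpa [sub_eq_zero] using this

/-- Frobenius lift. -/
def phi (p : ℕ) : LP →+* LP :=
  AddMonoidAlgebra.mapDomainRingHom ℤ (nsmulAddMonoidHom p : (ℤ × ℤ) →+ (ℤ × ℤ))

lemma phi_single (p : ℕ) (w : ℤ × ℤ) (n : ℤ) : phi p (AddMonoidAlgebra.single w n) =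
    AddMonoidAlgebra.single (p • w) n := by
  simp [phi]

lemma phi_congr {p : ℕ} (hp : p.Prime) (s : LP) : (p : LP) ∣ phi p s - s ^ p := by
  induction s using AddMonoidAlgebra.induction_linear with
  | zero => simp [hp.ne_zero]
  | add f g hf hg =>
    obtain ⟨r, hr⟩ := exists_add_pow_prime_eq hp f g
    rw [hr, map_add]
    have : phi p f + phi p g - (f ^ p + g ^ p + p * f * g * r) =
      (phi p f - f ^ p) + (phi p g - g ^ p) - p * (f * g * r) := by ring
    rw [this]
    exact dvd_sub (dvd_add hf hg) (dvd_mul_right _ _)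
  | single w n =>
    rw [phi_single, AddMonoidAlgebra.single_pow]
    have : (p : ℤ) ∣ n - n ^ p := by
      have := Fact.mk hp
      rw [← ZMod.intCast_zmod_eq_zero_iff_dvd]
      simp
    obtain ⟨k, hk⟩ := this
    refine ⟨AddMonoidAlgebra.single (p • w) k, ?_⟩
    rw [← AddMonoidAlgebra.single_sub, hk, ← nsmul_eq_mul p (AddMonoidAlgebra.single (p • w) k),
      AddMonoidAlgebra.smul_single, nsmul_eq_mul p k]

lemma phi_pow_congr {p : ℕ} (hp : p.Prime) (s : LP) (l : ℕ) :
    (p : LP) ^ (l + 1) ∣ phi p (s ^ p ^ l) - (s ^ p ^ l) ^ p := by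
  have := dvd_sub_pow_of_dvd_sub (phi_congr hp s) l
  rwa [← map_pow, ← pow_mul, mul_comm p, pow_mul] at this

def Lam (p : ℕ) (r : ℤ × ℤ) (y : Cfg G) : Cfg G := fun v => y (p • v + r)

lemma Lam_rho (p : ℕ) (r : ℤ × ℤ) (s : LP) (y : Cfg G) :
    Lam p r (rho G (phi p s) y) = rho G s (Lam p r y) := by
  induction s using AddMonoidAlgebra.induction_linear with
  | zero => funext v; simp [Lam]
  | add f g hf hg =>
    rw [map_add, map_add, map_add, LinearMap.add_apply, LinearMap.add_apply, ← hf, ← hg]; rfl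
  | single w n =>
    funext v
    rw [phi_single, rho_single]
    simp only [Lam, rho_single, smul_sub]
    congr 2
    abel

lemma rho_eq_of_dvd {p l : ℕ} (hl : ∀ g : G, (p ^ l) • g = 0) (s s' : LP)
    (h : (p : LP) ^ l ∣ s - s') (y : Cfg G) : rho G s y = rho G s' y := by
  obtain ⟨k, hk⟩ := h
  rw [← sub_eq_zero, ← LinearMap.sub_apply, ← map_sub, hk, ← Nat.cast_pow, map_mul, map_natCast,
    Module.End.mul_apply]
  funext v
  rw [Module.End.natCast_apply]
  simpa using hl _


lemma box_pow {q : LP} {D : ℤ} (hD : ∀ (L : ℤ) (y : Cfg G), Box L y → Box (L + D) (rho G q y))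
    (k : ℕ) (L : ℤ) (y : Cfg G) (hy : Box L y) : Box (L + k * D) (rho G (q ^ k) y) := by
  induction k with
  | zero => simpa using hy
  | succ k ih =>
    rw [pow_succ', map_mul, Module.End.mul_apply]
    refine (hD _ _ ih).mono (le_of_eq ?_)
    push_cast; ring

lemma abs_le_aux {p x r L D : ℤ} (hp : 0 < p) (hr0 : 0 ≤ r) (hr : r < p) (hL : D + 1 ≤ L)
    (h : |p * x + r| ≤ L + (p - 1) * D) : |x| ≤ L := by
  rw [abs_le] at h ⊢
  obtain ⟨h1, h2⟩ := h
  have h3 : (p - 1) * D + (p - 1) ≤ (p - 1) * L := by nlinarith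
  constructor
  · by_contra hc
    push Not at hc
    nlinarith
  · by_contra hc
    push Not at hc
    nlinarith

lemma kernel_step {p l : ℕ} (hp : p.Prime) (hl : ∀ g : G, (p ^ (l + 1)) • g = 0) (q s0 : LP)
    (hq : q = s0 ^ p ^ l) (D L : ℤ)
    (hD : ∀ (L : ℤ) (y : Cfg G), Box L y → Box (L + D) (rho G q y)) (hL : D + 1 ≤ L)
    (y : Cfg G) (hy : Half 0 y) (hb : Box L (rho G q y)) (r : ℤ × ℤ)
    (h1 : 0 ≤ r.1) (h1' : r.1 < p) (h2 : 0 ≤ r.2) (h2' : r.2 < p) :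
    Half 0 (Lam p r y) ∧ Box L (rho G q (Lam p r y)) := by
  have hp0 : (0 : ℤ) < p := by exact_mod_cast hp.pos
  constructor
  · intro v hv
    apply hy
    simp only [Prod.snd_add, Prod.smul_snd]
    simp only [nsmul_eq_mul]
    nlinarith
  · rw [← Lam_rho, rho_eq_of_dvd hl (phi p q) (q ^ p) (by rw [hq]; exact phi_pow_congr hp s0 l)]
    have : q ^ p = q ^ (p - 1) * q := by rw [← pow_succ, Nat.sub_add_cancel hp.one_le]
    rw [this, map_mul, Module.End.mul_apply]
    have hB := box_pow hD (p - 1) L _ hb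
    rw [Nat.cast_sub hp.one_le, Nat.cast_one] at hB
    intro v hv
    have := hB _ hv
    simp only [Prod.snd_add, Prod.smul_snd, Prod.fst_add, Prod.smul_fst] at this
    simp only [nsmul_eq_mul] at this
    exact ⟨abs_le_aux hp0 h1 h1' hL this.1, abs_le_aux hp0 h2 h2' hL this.2⟩

lemma finite_kernel [Finite G] (qp : Polynomial (AddMonoidAlgebra ℤ ℤ)) (hev : qp.eval 0 = 1)
    (L : ℤ) : Finite {y : Cfg G // Half 0 y ∧ Box L (rho G (Theta qp) y)} := by
  let S : Set (ℤ × ℤ) := Set.Icc (-L) L ×ˢ Set.Icc (-L) L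
  have hS : Finite S := (Set.finite_Icc _ _).prod (Set.finite_Icc _ _)
  refine Finite.of_injective
    (fun y : {y : Cfg G // Half 0 y ∧ Box L (rho G (Theta qp) y)} =>
      fun v : S => rho G (Theta qp) y.1 v.1) ?_
  intro y z h
  apply Subtype.ext
  apply inj_of_eval qp hev _ _ y.2.1 z.2.1
  funext v
  by_cases hv : v ∈ S
  · exact congrFun h ⟨v, hv⟩
  · have aux : ∀ y : Cfg G, Box L y → y v = 0 := by
      intro y hy
      by_contra h0
      have := hy v h0
      exact hv ⟨abs_le.1 this.1, abs_le.1 this.2⟩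
    rw [aux _ y.2.2, aux _ z.2.2]

theorem exists_states [Finite G] {p l : ℕ} (hp : p.Prime) (hl : ∀ g : G, (p ^ (l + 1)) • g = 0)
    (qp : Polynomial (AddMonoidAlgebra ℤ ℤ)) (hev : qp.eval 0 = 1) (s0 : LP)
    (hq : Theta qp = s0 ^ p ^ l) (X : Cfg G) (hX : Half 0 X) (L0 : ℤ)
    (hL0 : Box L0 (rho G (Theta qp) X)) :
    ∃ (Q : Type) (_ : Finite Q) (st : ℤ × ℤ → Q), ∀ (n : ℕ) (r : ℤ × ℤ), 0 ≤ r.1 → r.1 < p ^ n →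
      0 ≤ r.2 → r.2 < p ^ n → ∀ v w, st v = st w → X (p ^ n • v + r) = X (p ^ n • w + r) := by
  obtain ⟨D, hD0, hD⟩ := exists_box_rho (G := G) (Theta qp)
  set L := max L0 (D + 1) with hLdef
  have hfin := finite_kernel (G := G) qp hev L
  refine ⟨{y : Cfg G // Half 0 y ∧ Box L (rho G (Theta qp) y)} → G, inferInstance,
    fun v y => y.1 v, ?_⟩
  have hp0 : (0 : ℤ) < p := by exact_mod_cast hp.pos
  have key : ∀ (n : ℕ) (r : ℤ × ℤ), 0 ≤ r.1 → r.1 < p ^ n → 0 ≤ r.2 → r.2 < p ^ n →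
      ∀ y : Cfg G, Half 0 y ∧ Box L (rho G (Theta qp) y) →
      Half 0 (Lam (p ^ n) r y) ∧ Box L (rho G (Theta qp) (Lam (p ^ n) r y)) := by
    intro n
    induction n with
    | zero =>
      intro r h1 h1' h2 h2' y hy
      have : r = 0 := by ext <;> simp at * <;> omega
      have h : Lam (p ^ 0) r y = y := by funext v; simp [Lam, this]
      rw [h]; exact hy
    | succ n ih =>
      intro r h1 h1' h2 h2' y hy
      have hs := kernel_step hp hl (Theta qp) s0 hq D L hD (le_max_right _ _) y hy.1 hy.2
        (r.1 % p, r.2 % p) (Int.emod_nonneg _ hp0.ne') (Int.emod_lt_of_pos _ hp0)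
        (Int.emod_nonneg _ hp0.ne') (Int.emod_lt_of_pos _ hp0)
      have hi := ih (r.1 / p, r.2 / p) (Int.ediv_nonneg h1 hp0.le)
        (Int.ediv_lt_of_lt_mul hp0 (by rwa [← pow_succ])) (Int.ediv_nonneg h2 hp0.le)
        (Int.ediv_lt_of_lt_mul hp0 (by rwa [← pow_succ])) _ hs
      have e : Lam (p ^ n) (r.1 / p, r.2 / p) (Lam p (r.1 % p, r.2 % p) y) =
          Lam (p ^ (n + 1)) r y := by
        funext v
        simp only [Lam]
        congr 1
        have a1 := Int.emod_add_mul_ediv r.1 p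
        have a2 := Int.emod_add_mul_ediv r.2 p
        ext
        · simp only [Prod.fst_add, Prod.smul_fst]
          simp only [nsmul_eq_mul]
          push_cast
          linear_combination a1
        · simp only [Prod.snd_add, Prod.smul_snd]
          simp only [nsmul_eq_mul]
          push_cast
          linear_combination a2
      rw [e] at hi
      exact hi
  intro n r h1 h1' h2 h2' v w hvw
  exact congrFun hvw ⟨_, key n r h1 h1' h2 h2' X ⟨hX, hL0.mono (le_max_left _ _)⟩⟩

lemma exists_box_sum {ι : Type*} (s : Finset ι) (y : ι → Cfg G) (h : ∀ i, ∃ L, Box L (y i)) :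
    ∃ L, Box L (∑ i ∈ s, y i) := by
  classical
  induction s using Finset.induction_on with
  | empty => exact ⟨0, fun v hv => by simp at hv⟩
  | insert a s ha ih =>
    obtain ⟨L1, h1⟩ := ih
    obtain ⟨L2, h2⟩ := h a
    rw [Finset.sum_insert ha]
    exact ⟨max L1 L2, (h2.mono (le_max_right _ _)).add (h1.mono (le_max_left _ _))⟩

theorem exists_states_of_rec [Fintype G] {p l : ℕ} (hp : p.Prime)
    (hl : ∀ g : G, (p ^ (l + 1)) • g = 0)
    (f : G → ℤ → G) (T : G → Finset ℤ) (X : G → Cfg G) (hX : ∀ g, Half 0 (X g))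
    (hrec : ∀ g v, X g v = (if v = 0 then g else 0) + ∑ i ∈ T g, X (f g i) (v - (i, 1))) (ξ : G) :
    ∃ (Q : Type) (_ : Finite Q) (st : ℤ × ℤ → Q), ∀ (n : ℕ) (r : ℤ × ℤ), 0 ≤ r.1 → r.1 < p ^ n →
      0 ≤ r.2 → r.2 < p ^ n → ∀ v w, st v = st w → X ξ (p ^ n • v + r) = X ξ (p ^ n • w + r) := by
  classical
  let A : Matrix G G (AddMonoidAlgebra ℤ ℤ) := fun g h =>
    ∑ i ∈ T g, if f g i = h then AddMonoidAlgebra.single i 1 else 0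
  let M : Matrix G G (Polynomial (AddMonoidAlgebra ℤ ℤ)) :=
    1 - (Polynomial.X : Polynomial (AddMonoidAlgebra ℤ ℤ)) • A.map Polynomial.C
  let d : G → Cfg G := fun g v => if v = 0 then g else 0
  have hd : ∀ g, Box 0 (d g) := by
    intro g v hv
    have : v = 0 := by by_contra h; exact hv (by simp [d, h])
    simp [this]
  have hA : ∀ g v, (∑ h, rho G (embR (A g h)) (X h)) v = ∑ i ∈ T g, X (f g i) (v - (i, 0)) := by
    intro g v
    simp only [A, map_sum, LinearMap.sum_apply, Finset.sum_apply]
    rw [Finset.sum_comm]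
    refine Finset.sum_congr rfl fun i _ => ?_
    rw [Finset.sum_eq_single (f g i)]
    · rw [if_pos rfl, embR_single, rho_single, one_smul]
    · intro b _ hb
      rw [if_neg (Ne.symm hb)]; simp
    · simp
  have hM : ∀ g, ∑ h, rho G (Theta (M g h)) (X h) = d g := by
    intro g
    have e : ∀ h, rho G (Theta (M g h)) (X h) =
        (if g = h then X h else 0) - rho G tt (rho G (embR (A g h)) (X h)) := by
      intro h
      have : Theta (M g h) = (if g = h then 1 else 0) - tt * embR (A g h) := by
        simp only [M, Matrix.sub_apply, Matrix.smul_apply, Matrix.map_apply, Matrix.one_apply,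
          smul_eq_mul, map_sub, map_mul]
        congr 1
        · split_ifs <;> simp
        · simp [Theta]
      rw [this, map_sub, LinearMap.sub_apply, map_mul, Module.End.mul_apply]
      congr 1
      split_ifs <;> simp
    simp only [e, Finset.sum_sub_distrib, ← map_sum]
    rw [Finset.sum_ite_eq]
    funext v
    simp only [Finset.mem_univ, if_true, Pi.sub_apply]
    rw [tt, rho_single, hA, hrec g v, one_smul]
    simp only [d]
    rw [add_sub_assoc, sub_eq_zero.2, add_zero]
    refine Finset.sum_congr rfl fun i _ => ?_
    congr 1
    ext <;> simp
  have hdet : rho G (Theta A.charpolyRev) (X ξ) = ∑ g, rho G (Theta (M.adjugate ξ g)) (d g) := by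
    have h1 : ∀ h, ∑ g, M.adjugate ξ g * M g h = if ξ = h then A.charpolyRev else 0 := by
      intro h
      have := congrFun (congrFun (Matrix.adjugate_mul M) ξ) h
      rw [Matrix.mul_apply] at this
      rw [this, Matrix.smul_apply, Matrix.one_apply]
      simp only [smul_eq_mul, mul_ite, mul_one, mul_zero]
      rfl
    simp only [← hM, map_sum]
    rw [Finset.sum_comm]
    have h2 : ∀ h, ∑ g, rho G (Theta (M.adjugate ξ g)) (rho G (Theta (M g h)) (X h)) =
        if ξ = h then rho G (Theta A.charpolyRev) (X h) else 0 := by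
      intro h
      simp only [← Module.End.mul_apply, ← map_mul]
      rw [← LinearMap.sum_apply, ← map_sum, ← map_sum, h1]
      split_ifs <;> simp
    simp only [h2]
    simp
  obtain ⟨L1, hL1⟩ : ∃ L, Box L (rho G (Theta A.charpolyRev) (X ξ)) := by
    rw [hdet]
    apply exists_box_sum
    intro g
    obtain ⟨D, _, hD⟩ := exists_box_rho (G := G) (Theta (M.adjugate ξ g))
    exact ⟨_, hD 0 _ (hd g)⟩
  obtain ⟨D, _, hD⟩ := exists_box_rho (G := G) (Theta A.charpolyRev)
  have hpl : 1 ≤ p ^ l := Nat.one_le_pow _ _ hp.pos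
  refine exists_states hp hl (A.charpolyRev ^ p ^ l) (by simp) (Theta A.charpolyRev) (by simp)
    (X ξ) (hX ξ) (L1 + (p ^ l - 1 : ℕ) * D) ?_
  have : Theta (A.charpolyRev ^ p ^ l) = Theta A.charpolyRev ^ (p ^ l - 1) * Theta A.charpolyRev := by
    rw [← pow_succ, Nat.sub_add_cancel hpl, map_pow]
  rw [this, map_mul, Module.End.mul_apply]
  exact box_pow hD _ _ _ hL1


section CA

variable (F : (ℤ → G) →+ (ℤ → G))

lemma shift_int (hshift : ∀ r : ℤ → G, F (fun k => r (k - 1)) = fun n => F r (n - 1))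
    (k : ℤ) : ∀ r : ℤ → G, F (fun n => r (n - k)) = fun n => F r (n - k) := by
  induction k using Int.induction_on with
  | zero => intro r; simp
  | succ i ih =>
    intro r
    have h := hshift (fun m => r (m - i))
    rw [ih r] at h
    have e : (fun n : ℤ => r (n - ((i : ℤ) + 1))) = fun k => r (k - 1 - i) := by
      funext n; congr 1; ring
    rw [e, h]
    funext n; ring_nf
  | pred i ih =>
    intro r
    have h := hshift (fun m => r (m - (-(i : ℤ) - 1)))
    have e : (fun k : ℤ => r (k - 1 - (-(i : ℤ) - 1))) = fun k => r (k - (-(i : ℤ))) := by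
      funext n; congr 1; ring
    rw [e, ih r] at h
    funext n
    have := congrFun h (n + 1)
    simp only [add_sub_cancel_right] at this
    rw [← this]
    ring_nf

lemma finite_support_F (hshift : ∀ r : ℤ → G, F (fun k => r (k - 1)) = fun n => F r (n - 1))
    (I : Finset ℤ) (hlocal : ∀ r r' : ℤ → G, (∀ i ∈ I, r i = r' i) → F r 0 = F r' 0)
    (r : ℤ → G) (hr : (Function.support r).Finite) : (Function.support (F r)).Finite := by
  refine ((hr.prod I.finite_toSet).image (fun a : ℤ × ℤ => a.1 - a.2)).subset ?_
  intro n hn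
  by_contra hc
  apply hn
  have h := congrFun (shift_int F hshift (-n) r) 0
  simp only [zero_sub, neg_neg] at h
  rw [← h, hlocal _ 0, map_zero]
  · rfl
  · intro i hi
    by_contra h0
    exact hc ⟨(i - -n, i), ⟨h0, hi⟩, by simp⟩

def delta (g : G) : ℤ → G := fun k => if k = 0 then g else 0

lemma finite_support_iter (hshift : ∀ r : ℤ → G, F (fun k => r (k - 1)) = fun n => F r (n - 1))
    (I : Finset ℤ) (hlocal : ∀ r r' : ℤ → G, (∀ i ∈ I, r i = r' i) → F r 0 = F r' 0)
    (g : G) (j : ℕ) : (Function.support ((⇑F)^[j] (delta g))).Finite := by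
  induction j with
  | zero =>
    refine (Set.finite_singleton (0 : ℤ)).subset fun n hn => ?_
    by_contra h
    exact hn (if_neg h)
  | succ j ih =>
    rw [Function.iterate_succ_apply']
    exact finite_support_F F hshift I hlocal _ ih

def diag (g : G) : Cfg G := fun v => if v.2 < 0 then 0 else (⇑F)^[v.2.toNat] (delta g) v.1

lemma iter_sum_shift (hshift : ∀ r : ℤ → G, F (fun k => r (k - 1)) = fun n => F r (n - 1))
    (T : Finset ℤ) (y : ℤ → ℤ → G) (n : ℕ) :
    (⇑F)^[n] (∑ i ∈ T, fun k => y i (k - i)) = ∑ i ∈ T, fun k => (⇑F)^[n] (y i) (k - i) := by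
  induction n with
  | zero => rfl
  | succ n ih =>
    rw [Function.iterate_succ_apply', ih, map_sum]
    refine Finset.sum_congr rfl fun i _ => ?_
    rw [shift_int F hshift, Function.iterate_succ_apply']

theorem diag_states [Fintype G] {p : ℕ} (hp : p.Prime) (hpG : ∀ g : G, ∃ n : ℕ, (p ^ n) • g = 0)
    (hshift : ∀ r : ℤ → G, F (fun k => r (k - 1)) = fun n => F r (n - 1))
    (I : Finset ℤ) (hlocal : ∀ r r' : ℤ → G, (∀ i ∈ I, r i = r' i) → F r 0 = F r' 0) (ξ : G) :
    ∃ (Q : Type) (_ : Finite Q) (st : ℤ × ℤ → Q), ∀ (n : ℕ) (r : ℤ × ℤ), 0 ≤ r.1 → r.1 < p ^ n →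
      0 ≤ r.2 → r.2 < p ^ n → ∀ v w, st v = st w →
        diag F ξ (p ^ n • v + r) = diag F ξ (p ^ n • w + r) := by
  classical
  choose e he using hpG
  have hl : ∀ g : G, (p ^ ((∑ h, e h) + 1)) • g = 0 := by
    intro g
    have h1 : e g ≤ (∑ h, e h) + 1 :=
      (Finset.single_le_sum (f := e) (fun _ _ => Nat.zero_le _) (Finset.mem_univ g)).trans
        (Nat.le_succ _)
    obtain ⟨k, hk⟩ := pow_dvd_pow p h1
    rw [hk, mul_comm, mul_smul, he, smul_zero]
  let T : G → Finset ℤ := fun g => (finite_support_iter F hshift I hlocal g 1).toFinset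
  refine exists_states_of_rec hp hl (fun g => F (delta g)) T (diag F) ?_ ?_ ξ
  · intro g v hv
    simp [diag, hv]
  · intro g v
    obtain ⟨a, b⟩ := v
    have hdec : F (delta g) = ∑ i ∈ T g, fun k => delta (F (delta g) i) (k - i) := by
      funext k
      rw [Finset.sum_apply]
      by_cases hk : k ∈ T g
      · rw [Finset.sum_eq_single k]
        · simp [delta]
        · intro i _ hi
          exact if_neg (by omega)
        · intro h; exact absurd hk h
      · have h0 : F (delta g) k = 0 := by
          by_contra h0
          exact hk (by simp only [T, Set.Finite.mem_toFinset]; exact h0)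
        rw [h0, Finset.sum_eq_zero]
        intro i hi
        refine if_neg ?_
        rintro h
        have : k = i := by omega
        exact hk (this ▸ hi)
    rcases lt_trichotomy b 0 with hb | hb | hb
    · rw [if_neg, Finset.sum_eq_zero]
      · simp [diag, hb]
      · intro i _
        simp only [diag, Prod.snd_sub]
        rw [if_pos (by omega)]
      · intro h
        have := congrArg Prod.snd h
        simp at this
        omega
    · rw [Finset.sum_eq_zero]
      · subst hb
        simp [diag, delta, Prod.ext_iff]
      · intro i _
        simp only [diag, Prod.snd_sub]
        rw [if_pos (by omega)]
    · obtain ⟨n, rfl⟩ : ∃ n : ℕ, b = n + 1 := ⟨(b - 1).toNat, by omega⟩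
      rw [if_neg, zero_add]
      · simp only [diag, Prod.snd_sub, Prod.fst_sub]
        rw [if_neg (by omega)]
        have e1 : ((n : ℤ) + 1).toNat = n + 1 := by omega
        have e2 : ((n : ℤ) + 1 - 1).toNat = n := by omega
        have e3 : ¬ ((n : ℤ) + 1 - 1 < 0) := by omega
        simp only [e1, e2, e3, if_false]
        rw [Function.iterate_succ_apply]
        conv_lhs => rw [hdec]
        rw [iter_sum_shift F hshift, Finset.sum_apply]
      · intro h
        have := congrArg Prod.snd h
        simp at this
        omega

end CA

section Metric

variable {C : Type}

def Pic (x : ℤ → ℕ → Option C) (c₀ : C) (N : ℕ) : Set (ℝ × ℝ) :=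
  ⋃ (i : ℤ) (j : ℕ) (_ : j ≤ N) (_ : x i j = some c₀),
    Set.Icc ((i : ℝ) / (N : ℕ) - 1 / (2 * (N : ℕ))) ((i : ℝ) / (N : ℕ) + 1 / (2 * (N : ℕ))) ×ˢ
    Set.Icc ((j : ℝ) / (N : ℕ) - 1 / (2 * (N : ℕ))) ((j : ℝ) / (N : ℕ) + 1 / (2 * (N : ℕ)))

lemma isCompact_Pic (x : ℤ → ℕ → Option C) (hx : ∀ j, {i | x i j ≠ none}.Finite) (c₀ : C) (N : ℕ) :
    IsCompact (Pic x c₀ N) := by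
  have hfin : {a : ℤ × ℕ | a.2 ≤ N ∧ x a.1 a.2 = some c₀}.Finite := by
    refine (Set.Finite.biUnion (Set.finite_Iic N)
      (fun j _ => (hx j).image (fun i => (i, j)))).subset ?_
    rintro ⟨i, j⟩ ⟨h1, h2⟩
    simp only [Set.mem_iUnion]
    exact ⟨j, h1, i, by simp at h2; simp [h2], rfl⟩
  have : Pic x c₀ N = ⋃ a ∈ {a : ℤ × ℕ | a.2 ≤ N ∧ x a.1 a.2 = some c₀},
    Set.Icc ((a.1 : ℝ) / (N : ℕ) - 1 / (2 * (N : ℕ))) ((a.1 : ℝ) / (N : ℕ) + 1 / (2 * (N : ℕ))) ×ˢ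
    Set.Icc ((a.2 : ℝ) / (N : ℕ) - 1 / (2 * (N : ℕ))) ((a.2 : ℝ) / (N : ℕ) + 1 / (2 * (N : ℕ))) := by
    ext z
    simp only [Pic, Set.mem_iUnion, Set.mem_ofPred_eq, Prod.exists, exists_prop, and_assoc]
  rw [this]
  exact hfin.isCompact_biUnion fun a _ => isCompact_Icc.prod isCompact_Icc

/-- Existence of a cell of given color in the block of level `n` of a given state. -/
def TT {Q : Type} (p : ℕ) (col : ℤ × ℤ → Option C) (st : ℤ × ℤ → Q) (n : ℕ) : Q → C → Prop × Prop :=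
  fun q c =>
    (∃ v r : ℤ × ℤ, st v = q ∧ 0 ≤ r.1 ∧ r.1 < p ^ n ∧ 0 ≤ r.2 ∧ r.2 < p ^ n ∧
      col (p ^ n • v + r) = some c,
    ∃ v r : ℤ × ℤ, st v = q ∧ 0 ≤ r.1 ∧ r.1 < p ^ n ∧ r.2 = 0 ∧
      col (p ^ n • v + r) = some c)

lemma coord_close {p α β e : ℕ} (hp : 0 < p) {a r r' : ℤ} (h0 : 0 ≤ r) (h1 : r < p ^ α)
    (h0' : 0 ≤ r') (h1' : r' < p ^ β) :
    |(((p : ℤ) ^ α * a + r : ℤ) : ℝ) / (p ^ (α + e) : ℕ)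
      - (((p : ℤ) ^ β * a + r' : ℤ) : ℝ) / (p ^ (β + e) : ℕ)| ≤ 1 / (p : ℝ) ^ e := by
  have hp' : (0 : ℝ) < p := by exact_mod_cast hp
  have key : ∀ (α : ℕ) (r : ℤ), (((p : ℤ) ^ α * a + r : ℤ) : ℝ) / (p ^ (α + e) : ℕ) =
      (a + r / (p : ℝ) ^ α) * (1 / (p : ℝ) ^ e) := by
    intro α r
    push_cast
    rw [pow_add]
    field_simp
  have bd : ∀ (α : ℕ) (r : ℤ), 0 ≤ r → r < p ^ α → 0 ≤ (r / (p : ℝ) ^ α) ∧ r / (p : ℝ) ^ α ≤ 1 := by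
    intro α r h0 h1
    have h0 : (0 : ℝ) ≤ r := by exact_mod_cast h0
    have h1 : (r : ℝ) < p ^ α := by exact_mod_cast h1
    exact ⟨by positivity, (div_le_one (by positivity)).2 h1.le⟩
  rw [key, key, ← sub_mul, abs_mul, abs_of_pos (by positivity : 0 < 1 / (p : ℝ) ^ e)]
  obtain ⟨b1, b2⟩ := bd α r h0 h1
  obtain ⟨b3, b4⟩ := bd β r' h0' h1'
  refine mul_le_of_le_one_left (by positivity) ?_
  rw [abs_le]
  constructor <;> linarith

lemma transfer {Q : Type} {p : ℕ} (hp : p.Prime) (col : ℤ × ℤ → Option C) (st : ℤ × ℤ → Q)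
    (hst : ∀ (n : ℕ) (r : ℤ × ℤ), 0 ≤ r.1 → r.1 < p ^ n →
      0 ≤ r.2 → r.2 < p ^ n → ∀ v w, st v = st w → col (p ^ n • v + r) = col (p ^ n • w + r))
    {α β : ℕ} (h : TT p col st α = TT p col st β) (e : ℕ) (c : C) (i : ℤ) (j : ℕ)
    (hj : j ≤ p ^ (α + e)) (hc : col (i, j) = some c) :
    ∃ (i' : ℤ) (j' : ℕ), j' ≤ p ^ (β + e) ∧ col (i', j') = some c ∧
      |(i : ℝ) / (p ^ (α + e) : ℕ) - (i' : ℝ) / (p ^ (β + e) : ℕ)| ≤ 1 / (p : ℝ) ^ e ∧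
      |(j : ℝ) / (p ^ (α + e) : ℕ) - (j' : ℝ) / (p ^ (β + e) : ℕ)| ≤ 1 / (p : ℝ) ^ e := by
  have hpa : (0 : ℤ) < (p : ℤ) ^ α := by have := hp.pos; positivity
  have hpb : (0 : ℤ) < (p : ℤ) ^ β := by have := hp.pos; positivity
  obtain ⟨a, r, hi, hr0, hr1⟩ : ∃ a r : ℤ, i = p ^ α * a + r ∧ 0 ≤ r ∧ r < p ^ α :=
    ⟨i / p ^ α, i % p ^ α, (Int.mul_ediv_add_emod _ _).symm, Int.emod_nonneg _ hpa.ne',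
      Int.emod_lt_of_pos _ hpa⟩
  obtain ⟨b, s, hjj, hs0, hs1⟩ : ∃ b s : ℤ, (j : ℤ) = p ^ α * b + s ∧ 0 ≤ s ∧ s < p ^ α :=
    ⟨j / p ^ α, j % p ^ α, (Int.mul_ediv_add_emod _ _).symm, Int.emod_nonneg _ hpa.ne',
      Int.emod_lt_of_pos _ hpa⟩
  have hv : ((i, (j : ℤ)) : ℤ × ℤ) = p ^ α • ((a, b) : ℤ × ℤ) + (r, s) := by
    rw [hi, hjj]; ext <;> simp
  have hb0 : 0 ≤ b := by
    by_contra hb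
    push Not at hb
    have : (0 : ℤ) ≤ j := by positivity
    nlinarith
  have hjZ : (j : ℤ) ≤ p ^ α * p ^ e := by rw [← pow_add]; exact_mod_cast hj
  -- it suffices to find the offset
  suffices hsuf : ∃ r' s' : ℤ, 0 ≤ r' ∧ r' < p ^ β ∧ 0 ≤ s' ∧ s' < p ^ β ∧
      (p : ℤ) ^ β * b + s' ≤ p ^ β * p ^ e ∧ col (p ^ β • ((a, b) : ℤ × ℤ) + (r', s')) = some c by
    obtain ⟨r', s', h1, h2, h3, h4, h5, h6⟩ := hsuf
    have hnn : 0 ≤ (p : ℤ) ^ β * b + s' := by positivity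
    have hcast : ((((p : ℤ) ^ β * b + s').toNat : ℕ) : ℤ) = (p : ℤ) ^ β * b + s' :=
      Int.toNat_of_nonneg hnn
    refine ⟨p ^ β * a + r', ((p : ℤ) ^ β * b + s').toNat, ?_, ?_, ?_, ?_⟩
    · rw [← pow_add] at h5
      zify
      rw [hcast]; exact h5
    · rw [hcast, ← h6]
      congr 1
    · rw [hi]
      exact coord_close hp.pos hr0 hr1 h1 h2
    · have e1 : (j : ℝ) = (((p : ℤ) ^ α * b + s : ℤ) : ℝ) := by rw [← hjj]; simp
      have e2 : ((((p : ℤ) ^ β * b + s').toNat : ℕ) : ℝ) = (((p : ℤ) ^ β * b + s' : ℤ) : ℝ) := by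
        rw [← Int.cast_natCast (R := ℝ), hcast]
      rw [e1, e2]
      exact coord_close hp.pos hs0 hs1 h3 h4
  have hT := congrFun (congrFun h (st (a, b))) c
  have hT1 := congrArg Prod.fst hT
  have hT2 := congrArg Prod.snd hT
  simp only [TT] at hT1 hT2
  rw [hv] at hc
  by_cases hlt : b < p ^ e
  · obtain ⟨w, r', hw, h1, h2, h3, h4, h5⟩ :=
      hT1.mp ⟨(a, b), (r, s), rfl, hr0, hr1, hs0, hs1, hc⟩
    refine ⟨r'.1, r'.2, h1, h2, h3, h4, ?_, ?_⟩
    · nlinarith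
    · rw [← h5]
      exact (hst β r' h1 h2 h3 h4 w (a, b) hw).symm
  · push Not at hlt
    have hs : s = 0 := by nlinarith
    have hb : b = p ^ e := by
      apply le_antisymm _ hlt
      rw [hjj, hs, add_zero] at hjZ
      exact le_of_mul_le_mul_left hjZ hpa
    obtain ⟨w, r', hw, h1, h2, h3, h5⟩ :=
      hT2.mp ⟨(a, b), (r, s), rfl, hr0, hr1, hs, hc⟩
    refine ⟨r'.1, r'.2, h1, h2, h3.ge, by rw [h3]; exact hpb, ?_, ?_⟩
    · rw [h3, hb, add_zero]
    · rw [← h5]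
      exact (hst β r' h1 h2 h3.ge (by rw [h3]; exact hpb) w (a, b) hw).symm

lemma pic_close {Q : Type} {p : ℕ} (hp : p.Prime) (col : ℤ × ℤ → Option C) (st : ℤ × ℤ → Q)
    (hst : ∀ (n : ℕ) (r : ℤ × ℤ), 0 ≤ r.1 → r.1 < p ^ n →
      0 ≤ r.2 → r.2 < p ^ n → ∀ v w, st v = st w → col (p ^ n • v + r) = col (p ^ n • w + r))
    {α β : ℕ} (h : TT p col st α = TT p col st β) (e : ℕ) (c : C) (z : ℝ × ℝ)
    (hz : z ∈ Pic (fun i j => col (i, (j : ℤ))) c (p ^ (α + e))) :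
    ∃ z' ∈ Pic (fun i j => col (i, (j : ℤ))) c (p ^ (β + e)),
      edist z z' ≤ ENNReal.ofReal (2 / (p : ℝ) ^ e) := by
  have hp' : (0 : ℝ) < p := by exact_mod_cast hp.pos
  simp only [Pic, Set.mem_iUnion] at hz
  obtain ⟨i, j, hj, hc, hz⟩ := hz
  obtain ⟨i', j', hj', hc', h1, h2⟩ := transfer hp col st hst h e c i j hj hc
  have hN : (1 : ℝ) / (2 * ((p ^ (α + e) : ℕ) : ℝ)) ≤ 1 / (p : ℝ) ^ e := by
    apply one_div_le_one_div_of_le (by positivity)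
    push_cast
    rw [pow_add]
    have : (1 : ℝ) ≤ (p : ℝ) ^ α := one_le_pow₀ (by exact_mod_cast hp.one_le)
    have : (0 : ℝ) < (p : ℝ) ^ e := by positivity
    nlinarith
  refine ⟨((i' : ℝ) / (p ^ (β + e) : ℕ), (j' : ℝ) / (p ^ (β + e) : ℕ)), ?_, ?_⟩
  · simp only [Pic, Set.mem_iUnion]
    have : (0 : ℝ) ≤ 1 / (2 * ((p ^ (β + e) : ℕ) : ℝ)) := by positivity
    refine ⟨i', j', hj', hc', ⟨⟨?_, ?_⟩, ?_, ?_⟩⟩ <;> simp only <;> linarith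
  · rw [edist_dist]
    apply ENNReal.ofReal_le_ofReal
    obtain ⟨⟨z1, z2⟩, z3, z4⟩ := hz
    have e2 : 2 / (p : ℝ) ^ e = 1 / (p : ℝ) ^ e + 1 / (p : ℝ) ^ e := by ring
    rw [Prod.dist_eq, Real.dist_eq, Real.dist_eq, e2]
    rw [abs_le] at h1 h2
    refine max_le ?_ ?_ <;> rw [abs_le] <;> constructor <;> simp only <;> linarith

theorem pic_limit [Finite C] {Q : Type} [Finite Q] {p : ℕ} (hp : p.Prime)
    (col : ℤ × ℤ → Option C) (st : ℤ × ℤ → Q)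
    (hst : ∀ (n : ℕ) (r : ℤ × ℤ), 0 ≤ r.1 → r.1 < p ^ n →
      0 ≤ r.2 → r.2 < p ^ n → ∀ v w, st v = st w → col (p ^ n • v + r) = col (p ^ n • w + r))
    (hfin : ∀ j : ℕ, {i : ℤ | col (i, (j : ℤ)) ≠ none}.Finite) :
    ∃ m : ℕ, 0 < m ∧ ∀ c₀ : C, ∃ K : Set (ℝ × ℝ), IsCompact K ∧
      Tendsto (fun n : ℕ => Metric.hausdorffEDist
        (Pic (fun i j => col (i, (j : ℤ))) c₀ (p ^ (m * n))) K) atTop (nhds 0) := by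
  obtain ⟨n0, m, hm, hT⟩ : ∃ n0 m : ℕ, 0 < m ∧ TT p col st n0 = TT p col st (n0 + m) := by
    obtain ⟨a, b, hab, h⟩ := Finite.exists_ne_map_eq_of_infinite (TT p col st)
    rcases lt_or_gt_of_ne hab with hl | hl
    · exact ⟨a, b - a, by omega, by rw [h]; congr 1; omega⟩
    · exact ⟨b, a - b, by omega, by rw [← h]; congr 1; omega⟩
  refine ⟨m, hm, fun c => ?_⟩
  let f : ℕ → TopologicalSpace.Compacts (ℝ × ℝ) := fun k =>
    ⟨Pic (fun i j => col (i, (j : ℤ))) c (p ^ (m * (k + n0))), isCompact_Pic _ hfin _ _⟩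
  have hf : ∀ k, edist (f k) (f (k + 1)) ≤ 2 / 2 ^ k := by
    intro k
    obtain ⟨e, he⟩ : ∃ e, m * (k + n0) = n0 + e := ⟨m * (k + n0) - n0, by
      have : n0 ≤ m * (k + n0) := by nlinarith
      omega⟩
    have he' : m * (k + 1 + n0) = n0 + m + e := by
      have : m * (k + 1 + n0) = m * (k + n0) + m := by ring
      omega
    have hke : k ≤ e := by nlinarith
    have hle : ENNReal.ofReal (2 / (p : ℝ) ^ e) ≤ 2 / 2 ^ k := by
      have h2 : (2 : ENNReal) / 2 ^ k = ENNReal.ofReal (2 / 2 ^ k) := by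
        rw [ENNReal.ofReal_div_of_pos (by positivity), ENNReal.ofReal_pow (by norm_num)]
        simp
      rw [h2]
      apply ENNReal.ofReal_le_ofReal
      apply div_le_div_of_nonneg_left (by norm_num) (by positivity)
      calc (2 : ℝ) ^ k ≤ 2 ^ e := pow_le_pow_right₀ (by norm_num) hke
        _ ≤ (p : ℝ) ^ e := pow_le_pow_left₀ (by norm_num) (by exact_mod_cast hp.two_le) e
    rw [TopologicalSpace.Compacts.edist_eq]
    refine Metric.hausdorffEDist_le_of_mem_edist ?_ ?_
    · intro z hz
      change z ∈ Pic _ c (p ^ (m * (k + n0))) at hz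
      rw [he] at hz
      obtain ⟨z', hz', hd⟩ := pic_close hp col st hst hT e c z hz
      refine ⟨z', ?_, hd.trans hle⟩
      change z' ∈ Pic _ c (p ^ (m * (k + 1 + n0)))
      rwa [he']
    · intro z hz
      change z ∈ Pic _ c (p ^ (m * (k + 1 + n0))) at hz
      rw [he'] at hz
      obtain ⟨z', hz', hd⟩ := pic_close hp col st hst hT.symm e c z hz
      refine ⟨z', ?_, hd.trans hle⟩
      change z' ∈ Pic _ c (p ^ (m * (k + n0)))
      rwa [he]
  obtain ⟨K, hK⟩ := cauchySeq_tendsto_of_complete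
    (cauchySeq_of_edist_le_geometric_two 2 (by norm_num) hf)
  refine ⟨K, K.isCompact, ?_⟩
  rw [← tendsto_add_atTop_iff_nat n0]
  exact tendsto_iff_edist_tendsto_0.1 hK

end Metric

end
end AbCA

/-- For a cellular automaton `F` on a finite abelian `p`-group `G`
(an additive endomorphism of the configuration space commuting with the shift and local
with neighborhood `I`), a fixed initial state `ξ` and a coloring `𝔠 : G → Option C`
(`none` being the blank color, assigned to `0`), there is a positive integer `m` such that
for every color `c₀` the colored spacetime diagrams of order `p ^ (m * n)` converge, in the
extended Hausdorff distance, to a compact subset of the plane. -/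
theorem fractal_structure_of_abelian_CA
    (p : ℕ) (hp : p.Prime)
    (G : Type) [AddCommGroup G] [Fintype G]
    (hpG : ∀ g : G, ∃ n : ℕ, (p ^ n) • g = 0)
    (F : (ℤ → G) →+ (ℤ → G))
    (hshift : ∀ r : ℤ → G, F (fun k => r (k - 1)) = fun n => F r (n - 1))
    (I : Finset ℤ)
    (hlocal : ∀ r r' : ℤ → G, (∀ i ∈ I, r i = r' i) → F r 0 = F r' 0)
    (ξ : G)
    (C : Type) [Fintype C] (𝔠 : G → Option C) (hblank : 𝔠 0 = none) :
    ∃ m : ℕ, 0 < m ∧ ∀ c₀ : C, ∃ K : Set (ℝ × ℝ), IsCompact K ∧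
      Tendsto
        (fun n : ℕ =>
          EMetric.hausdorffEdist
            (⋃ (i : ℤ) (j : ℕ) (_ : j ≤ p ^ (m * n))
                (_ : 𝔠 ((⇑F)^[j] (fun k => if k = 0 then ξ else 0) i) = some c₀),
              Set.Icc ((i : ℝ) / (p ^ (m * n) : ℕ) - 1 / (2 * (p ^ (m * n) : ℕ)))
                      ((i : ℝ) / (p ^ (m * n) : ℕ) + 1 / (2 * (p ^ (m * n) : ℕ))) ×ˢ
              Set.Icc ((j : ℝ) / (p ^ (m * n) : ℕ) - 1 / (2 * (p ^ (m * n) : ℕ)))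
                      ((j : ℝ) / (p ^ (m * n) : ℕ) + 1 / (2 * (p ^ (m * n) : ℕ))))
            K)
        atTop (nhds 0) := by
  obtain ⟨Q, hQ, st, hst⟩ := AbCA.diag_states F hp hpG hshift I hlocal ξ
  have hx : ∀ (i : ℤ) (j : ℕ), AbCA.diag F ξ (i, (j : ℤ)) =
      (⇑F)^[j] (fun k => if k = 0 then ξ else 0) i := by
    intro i j
    simp only [AbCA.diag]
    rw [if_neg (by omega)]
    rfl
  obtain ⟨m, hm, h⟩ := AbCA.pic_limit hp (fun v => 𝔠 (AbCA.diag F ξ v)) st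
    (fun n r h1 h2 h3 h4 v w hvw => congrArg 𝔠 (hst n r h1 h2 h3 h4 v w hvw)) (by
      intro j
      refine (AbCA.finite_support_iter F hshift I hlocal ξ j).subset fun i hi h0 => hi ?_
      rw [hx]
      change 𝔠 ((⇑F)^[j] (AbCA.delta ξ) i) = none
      rw [h0, hblank])
  refine ⟨m, hm, fun c₀ => ?_⟩
  obtain ⟨K, hK, ht⟩ := h c₀
  refine ⟨K, hK, ?_⟩
  simp only [hx] at ht
  exact ht
end

section
/- For every prime p, every finite abelian p-group G, and every group endomorphism α of G, there exist positive integers k and d, an injective group homomorphism s : G → (ZMod (p^k))^d, and an additive endomorphism A of (ZMod (p^k))^d such that s ∘ α = A ∘ s. -/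
/-- Separation of points by homomorphisms to `ZMod N` when `N` kills `G`. -/
lemma exists_hom_zmod_ne_zero (N : ℕ) (hN : 0 < N) (G : Type) [AddCommGroup G] [Finite G]
    (h : ∀ g : G, N • g = 0) (g : G) (hg : g ≠ 0) : ∃ φ : G →+ ZMod N, φ g ≠ 0 := by
  classical
  obtain ⟨ι, _, n, hn, ⟨e⟩⟩ := AddCommGroup.equiv_directSum_zmod_of_finite' G
  have h1 : e g ≠ 0 := by simpa using hg
  obtain ⟨i, hi⟩ : ∃ i, (e g) i ≠ 0 := by
    by_contra! hc
    exact h1 (DFinsupp.ext hc)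
  have hdvd : n i ∣ N := by
    have h2 : N • (DirectSum.of (fun i => ZMod (n i)) i 1) = 0 := by
      have := congrArg e (h (e.symm (DirectSum.of (fun i => ZMod (n i)) i 1)))
      simpa only [map_nsmul, AddEquiv.apply_symm_apply, map_zero] using this
    rw [← map_nsmul] at h2
    have h3 := DirectSum.of_injective (β := fun i => ZMod (n i)) i (h2.trans (map_zero _).symm)
    rw [nsmul_one] at h3
    exact (ZMod.natCast_eq_zero_iff _ _).1 h3
  obtain ⟨m, hm⟩ := hdvd
  have hm0 : (m : ℤ) ≠ 0 := by
    rintro hm0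
    have : m = 0 := by exact_mod_cast hm0
    subst this
    omega
  let ψ : ZMod (n i) →+ ZMod N := ZMod.lift (n i)
    ⟨(AddMonoidHom.mulLeft (m : ZMod N)).comp (Int.castAddHom (ZMod N)), by
      have : ((m * n i : ℕ) : ZMod N) = 0 := by
        rw [mul_comm, ← hm]; simp
      simpa using this⟩
  have hψ : Function.Injective ψ := by
    rw [ZMod.lift_injective]
    intro z hz
    have hz' : ((m * z : ℤ) : ZMod N) = 0 := by simpa using hz
    rw [ZMod.intCast_zmod_eq_zero_iff_dvd, hm] at hz'
    rw [ZMod.intCast_zmod_eq_zero_iff_dvd]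
    push_cast at hz'
    rw [mul_comm] at hz'
    exact Int.dvd_of_mul_dvd_mul_left hm0 hz'
  refine ⟨(ψ.comp (DFinsupp.evalAddMonoidHom i)).comp e.toAddMonoidHom, fun h0 => hi ?_⟩
  exact hψ (h0.trans (map_zero ψ).symm)

/-- Every endomorphism `α` of a finite abelian `p`-group `G` factors
through an embedding `s` of `G` into `(ZMod (p ^ k)) ^ d` and an additive endomorphism `A`
of `(ZMod (p ^ k)) ^ d`, so that `s ∘ α = A ∘ s`. -/
theorem pGroup_endomorphism_embeds
    (p : ℕ) (hp : p.Prime)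
    (G : Type) [AddCommGroup G] [Fintype G]
    (hpG : ∀ g : G, ∃ n : ℕ, (p ^ n) • g = 0)
    (α : G →+ G) :
    ∃ (k d : ℕ), 0 < k ∧ 0 < d ∧
      ∃ (s : G →+ (Fin d → ZMod (p ^ k)))
        (A : (Fin d → ZMod (p ^ k)) →+ (Fin d → ZMod (p ^ k))),
        Function.Injective s ∧ ∀ g : G, s (α g) = A (s g) := by
  classical
  choose n hn using hpG
  let k := ∑ g, n g + 1
  have hk : ∀ g : G, (p ^ k) • g = 0 := by
    intro g
    have hle : n g ≤ k :=
      (Finset.single_le_sum (f := n) (fun _ _ => Nat.zero_le _) (Finset.mem_univ g)).trans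
        (Nat.le_succ _)
    obtain ⟨c, hc⟩ := pow_dvd_pow p hle
    rw [hc, mul_comm, mul_smul, hn, smul_zero]
  have hN : 0 < p ^ k := pow_pos hp.pos k
  haveI : NeZero (p ^ k) := ⟨hN.ne'⟩
  haveI : Finite (G →+ ZMod (p ^ k)) := Finite.of_injective _ DFunLike.coe_injective
  let E := Finite.equivFin (G →+ ZMod (p ^ k))
  refine ⟨k, Nat.card (G →+ ZMod (p ^ k)), Nat.succ_pos _, Nat.card_pos,
    { toFun := fun g j => E.symm j g
      map_zero' := by ext j; simp
      map_add' := by intro a b; ext j; simp },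
    { toFun := fun f j => f (E ((E.symm j).comp α))
      map_zero' := by ext j; simp
      map_add' := by intro a b; ext j; simp }, ?_, ?_⟩
  · rw [injective_iff_map_eq_zero]
    intro g hg
    by_contra hne
    obtain ⟨φ, hφ⟩ := exists_hom_zmod_ne_zero (p ^ k) hN G hk g hne
    apply hφ
    have := congrFun hg (E φ)
    simpa using this
  · intro g
    ext j
    simp
end

section
/- Let V be a finite set, r ≥ 2 an integer, D : V → (Fin r × Fin r → V) a matrix substitution system, C a finite set of colors, and 𝔠 : V → C a coloring. Fix v₀ ∈ V, and define arrays a_n : Fin(r^n) × Fin(r^n) → V recursively by a_0(0,0) = v₀ and a_{n+1}(r·i+s, r·j+t) = D(a_n(i,j))(s,t) for 0 ≤ i,j < r^n and 0 ≤ s,t < r. Let Γ be the directed graph on vertex set V with an edge from v to w iff w = D(v)(s,t) for some s,t. If every vertex of Γ lying on a closed walk is aperiodic (i.e., the gcd of the lengths of closed walks at that vertex is 1), then for every color c₀ ∈ C the sequence of patterns (P_n(c₀))_{n∈ℕ} converges in the extended Hausdorff distance to some closed subset of [0,1]². -/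
open Filter

/-- `IsWalk E n v w` : there is a walk of length `n` from `v` to `w` in the directed
graph with edge relation `E`. -/
def IsWalk {V : Type} (E : V → V → Prop) : ℕ → V → V → Prop
  | 0, v, w => v = w
  | n + 1, v, w => ∃ u, E v u ∧ IsWalk E n u w

theorem IsWalk.trans {V : Type} {E : V → V → Prop} : ∀ {m n : ℕ} {u v w : V},
    IsWalk E m u v → IsWalk E n v w → IsWalk E (m + n) u w
  | 0, n, u, v, w, h1, h2 => by
    have : u = v := h1
    subst this; simpa using h2
  | m + 1, n, u, v, w, ⟨x, hx, h1⟩, h2 => by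
    rw [Nat.add_right_comm]
    exact ⟨x, hx, IsWalk.trans h1 h2⟩

theorem IsWalk.exists_path {V : Type} {E : V → V → Prop} : ∀ {n : ℕ} {v w : V},
    IsWalk E n v w → ∃ f : ℕ → V, f 0 = v ∧ f n = w ∧ ∀ i < n, E (f i) (f (i + 1))
  | 0, v, w, h => ⟨fun _ => v, rfl, h, by simp⟩
  | n + 1, v, w, ⟨u, hu, h⟩ => by
    obtain ⟨f, h0, hn, hf⟩ := IsWalk.exists_path h
    refine ⟨fun i => Nat.casesOn i v f, rfl, hn, ?_⟩
    rintro (_ | i) hi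
    · simpa [h0] using hu
    · exact hf i (by omega)

theorem isWalk_of_path {V : Type} {E : V → V → Prop} (f : ℕ → V) : ∀ (m i : ℕ),
    (∀ k, i ≤ k → k < i + m → E (f k) (f (k + 1))) → IsWalk E m (f i) (f (i + m))
  | 0, i, _ => rfl
  | m + 1, i, h => by
    refine ⟨f (i + 1), h i le_rfl (by omega), ?_⟩
    have := isWalk_of_path f m (i + 1) (fun k h1 h2 => h k (by omega) (by omega))
    rwa [show i + 1 + m = i + (m + 1) by omega] at this

theorem walk_through_cycle {V : Type} [Fintype V] {E : V → V → Prop} {n : ℕ} {v w : V}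
    (h : IsWalk E n v w) (hn : Fintype.card V ≤ n) :
    ∃ u p l q, IsWalk E p v u ∧ 0 < l ∧ IsWalk E l u u ∧ IsWalk E q u w := by
  obtain ⟨f, h0, hfn, hf⟩ := h.exists_path
  obtain ⟨x, y, hxy, hfxy⟩ := Fintype.exists_ne_map_eq_of_card_lt
    (fun i : Fin (n + 1) => f i) (by simp; omega)
  wlog hlt : x < y generalizing x y
  · exact this y x hxy.symm hfxy.symm (lt_of_le_of_ne (not_lt.mp hlt) hxy.symm)
  have hlt' : (x : ℕ) < y := hlt
  have hy := y.2
  refine ⟨f x, x, y - x, n - y, ?_, by omega, ?_, ?_⟩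
  · have := isWalk_of_path (E := E) f x 0 (fun k _ h2 => hf k (by omega))
    rwa [h0, Nat.zero_add] at this
  · have := isWalk_of_path (E := E) f (y - x) x (fun k _ h2 => hf k (by omega))
    rw [show (x : ℕ) + (y - x) = y by omega] at this
    rwa [← hfxy] at this
  · have := isWalk_of_path (E := E) f (n - y) y (fun k _ h2 => hf k (by omega))
    rw [show (y : ℕ) + (n - y) = n by omega, hfn] at this
    rwa [← hfxy] at this

theorem large_closed_walks {V : Type} {E : V → V → Prop} (u : V)
    (h : ∀ d : ℕ, (∀ n, 0 < n → IsWalk E n u u → d ∣ n) → d = 1) :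
    ∃ N, ∀ n ≥ N, IsWalk E n u u := by
  let S : AddSubmonoid ℕ :=
    { carrier := {n | IsWalk E n u u}
      zero_mem' := rfl
      add_mem' := fun h1 h2 => IsWalk.trans h1 h2 }
  obtain ⟨N, hN⟩ := Nat.exists_mem_closure_of_ge (S : Set ℕ)
  have h1 : Nat.setGcd (S : Set ℕ) = 1 := h _ fun n _ hn => Nat.setGcd_dvd_of_mem hn
  refine ⟨N, fun n hn => ?_⟩
  have := hN n hn (by simp [h1])
  rwa [AddSubmonoid.closure_eq] at this

theorem uniform_color {V : Type} [Fintype V] {E : V → V → Prop} (P : V → Prop)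
    (h : ∀ v : V, (∃ n, 0 < n ∧ IsWalk E n v v) →
      ∀ d : ℕ, (∀ n, 0 < n → IsWalk E n v v → d ∣ n) → d = 1) :
    ∃ N, ∀ v : V, ∀ m ≥ N, ∀ m' ≥ N, (∃ w, P w ∧ IsWalk E m v w) →
      ∃ w, P w ∧ IsWalk E m' v w := by
  have key : ∀ v : V, ∃ N, ∀ m ≥ N, ∀ m' ≥ N, (∃ w, P w ∧ IsWalk E m v w) →
      ∃ w, P w ∧ IsWalk E m' v w := by
    intro v
    by_cases hv : ∃ m ≥ Fintype.card V, ∃ w, P w ∧ IsWalk E m v w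
    · obtain ⟨m, hm, w, hw, hwalk⟩ := hv
      obtain ⟨u, p, l, q, h1, hl, h2, h3⟩ := walk_through_cycle hwalk hm
      obtain ⟨N, hN⟩ := large_closed_walks u (h u ⟨l, hl, h2⟩)
      refine ⟨p + N + q, fun _ _ m' hm' _ => ⟨w, hw, ?_⟩⟩
      have := (h1.trans (hN (m' - p - q) (by omega))).trans h3
      rwa [show p + (m' - p - q) + q = m' by omega] at this
    · exact ⟨Fintype.card V, fun m hm _ _ hx => (hv ⟨m, hm, hx⟩).elim⟩
  choose N hN using key
  refine ⟨Finset.univ.sup N, fun v m hm m' hm' => hN v m ?_ m' ?_⟩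
  · exact (Finset.le_sup (Finset.mem_univ v)).trans hm
  · exact (Finset.le_sup (Finset.mem_univ v)).trans hm'

section arrays

variable {V : Type} {r : ℕ} {D : V → (Fin r × Fin r → V)} {a : ℕ → ℕ → ℕ → V}

theorem walk_of_cell (hr : 2 ≤ r)
    (harec : ∀ (n i j : ℕ), i < r ^ n → j < r ^ n → ∀ s t : Fin r,
      a (n + 1) (r * i + s) (r * j + t) = D (a n i j) (s, t)) :
    ∀ (m k i j p q : ℕ), i < r ^ k → j < r ^ k → p < r ^ m → q < r ^ m →
      IsWalk (fun v w => ∃ s t : Fin r, D v (s, t) = w) m (a k i j)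
        (a (k + m) (r ^ m * i + p) (r ^ m * j + q))
  | 0, k, i, j, p, q, hi, hj, hp, hq => by
    simp only [pow_zero, Nat.lt_one_iff] at hp hq
    subst hp hq
    simp [IsWalk]
  | m + 1, k, i, j, p, q, hi, hj, hp, hq => by
    have hpos : 0 < r ^ m := by positivity
    have hs : p / r ^ m < r := Nat.div_lt_of_lt_mul (by rwa [← pow_succ])
    have ht : q / r ^ m < r := Nat.div_lt_of_lt_mul (by rwa [← pow_succ])
    refine ⟨_, ⟨⟨_, hs⟩, ⟨_, ht⟩, rfl⟩, ?_⟩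
    rw [← harec k i j hi hj]
    have hlt : ∀ x y, x < r ^ k → y < r → r * x + y < r ^ (k + 1) := by
      intro x y hx hy
      have : r * (x + 1) ≤ r * r ^ k := Nat.mul_le_mul_left _ hx
      rw [pow_succ']; linarith
    have := walk_of_cell hr harec m (k + 1) _ _ (p % r ^ m) (q % r ^ m) (hlt i _ hi hs)
      (hlt j _ hj ht) (Nat.mod_lt _ hpos) (Nat.mod_lt _ hpos)
    have e : ∀ x y, r ^ m * (r * x + y / r ^ m) + y % r ^ m = r ^ (m + 1) * x + y := by
      intro x y
      have := Nat.div_add_mod y (r ^ m)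
      rw [mul_add, add_assoc, this, pow_succ, mul_assoc]
    rw [e, e, show k + 1 + m = k + (m + 1) by omega] at this
    exact this

theorem cell_of_walk (hr : 2 ≤ r)
    (harec : ∀ (n i j : ℕ), i < r ^ n → j < r ^ n → ∀ s t : Fin r,
      a (n + 1) (r * i + s) (r * j + t) = D (a n i j) (s, t)) :
    ∀ (m k i j : ℕ) (w : V), i < r ^ k → j < r ^ k →
      IsWalk (fun v w => ∃ s t : Fin r, D v (s, t) = w) m (a k i j) w →
      ∃ p q, p < r ^ m ∧ q < r ^ m ∧ a (k + m) (r ^ m * i + p) (r ^ m * j + q) = w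
  | 0, k, i, j, w, hi, hj, h => ⟨0, 0, by simp, by simp, by simpa [IsWalk] using h⟩
  | m + 1, k, i, j, w, hi, hj, ⟨u, ⟨s, t, hst⟩, h⟩ => by
    rw [← hst, ← harec k i j hi hj] at h
    have hlt : ∀ x y, x < r ^ k → y < r → r * x + y < r ^ (k + 1) := by
      intro x y hx hy
      have : r * (x + 1) ≤ r * r ^ k := Nat.mul_le_mul_left _ hx
      rw [pow_succ']; linarith
    obtain ⟨p, q, hp, hq, hpq⟩ := cell_of_walk hr harec m (k + 1) _ _ w
      (hlt i _ hi s.2) (hlt j _ hj t.2) h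
    have hlt2 : ∀ x y, x < r ^ m → y < r → r ^ m * y + x < r ^ (m + 1) := by
      intro x y hx hy
      have : r ^ m * (y + 1) ≤ r ^ m * r := Nat.mul_le_mul_left _ hy
      rw [pow_succ]; linarith
    refine ⟨r ^ m * s + p, r ^ m * t + q, hlt2 _ _ hp s.2, hlt2 _ _ hq t.2, ?_⟩
    rw [← hpq, show k + 1 + m = k + (m + 1) by omega]
    congr 1 <;> ring

end arrays

/-- The pattern at level `n`. -/
def pat {V C : Type} (r : ℕ) (𝔠 : V → C) (a : ℕ → ℕ → ℕ → V) (c₀ : C) (n : ℕ) : Set (ℝ × ℝ) :=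
  (⋃ (i : ℕ) (j : ℕ) (_ : i < r ^ n) (_ : j < r ^ n) (_ : 𝔠 (a n i j) = c₀),
              Set.Icc ((i : ℝ) / (r ^ n : ℕ)) (((i : ℝ) + 1) / (r ^ n : ℕ)) ×ˢ
              Set.Icc ((j : ℝ) / (r ^ n : ℕ)) (((j : ℝ) + 1) / (r ^ n : ℕ)))

theorem mem_pat {V C : Type} {r : ℕ} {𝔠 : V → C} {a : ℕ → ℕ → ℕ → V} {c₀ : C} {n : ℕ}
    {x : ℝ × ℝ} : x ∈ pat r 𝔠 a c₀ n ↔ ∃ i j, i < r ^ n ∧ j < r ^ n ∧ 𝔠 (a n i j) = c₀ ∧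
      x.1 ∈ Set.Icc ((i : ℝ) / (r ^ n : ℕ)) (((i : ℝ) + 1) / (r ^ n : ℕ)) ∧
      x.2 ∈ Set.Icc ((j : ℝ) / (r ^ n : ℕ)) (((j : ℝ) + 1) / (r ^ n : ℕ)) := by
  simp only [pat, Set.mem_iUnion, Set.mem_prod, exists_prop]

theorem isClosed_pat {V C : Type} {r : ℕ} {𝔠 : V → C} {a : ℕ → ℕ → ℕ → V} {c₀ : C} {n : ℕ} :
    IsClosed (pat r 𝔠 a c₀ n) := by
  have : pat r 𝔠 a c₀ n = ⋃ ij ∈ {ij : ℕ × ℕ | ij.1 < r ^ n ∧ ij.2 < r ^ n ∧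
      𝔠 (a n ij.1 ij.2) = c₀},
      Set.Icc ((ij.1 : ℝ) / (r ^ n : ℕ)) (((ij.1 : ℝ) + 1) / (r ^ n : ℕ)) ×ˢ
      Set.Icc ((ij.2 : ℝ) / (r ^ n : ℕ)) (((ij.2 : ℝ) + 1) / (r ^ n : ℕ)) := by
    ext x
    simp only [mem_pat, Set.mem_iUnion, Set.mem_prod, exists_prop, Prod.exists, Set.mem_setOf_eq,
      and_assoc]
  rw [this]
  refine Set.Finite.isClosed_biUnion ?_ fun _ _ => isClosed_Icc.prod isClosed_Icc
  refine ((Set.finite_Iio (r ^ n)).prod (Set.finite_Iio (r ^ n))).subset ?_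
  rintro ⟨i, j⟩ ⟨h1, h2, -⟩
  exact ⟨h1, h2⟩

theorem pat_subset {V C : Type} {r : ℕ} (hr : 2 ≤ r) {𝔠 : V → C} {a : ℕ → ℕ → ℕ → V} {c₀ : C}
    {n : ℕ} : pat r 𝔠 a c₀ n ⊆ Set.Icc (0 : ℝ) 1 ×ˢ Set.Icc (0 : ℝ) 1 := by
  intro x hx
  obtain ⟨i, j, hi, hj, -, ⟨h1, h2⟩, h3, h4⟩ := mem_pat.1 hx
  have hpos : (0 : ℝ) < (r ^ n : ℕ) := by positivity
  have hle : ∀ i : ℕ, i < r ^ n → ((i : ℝ) + 1) / (r ^ n : ℕ) ≤ 1 := by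
    intro i hi
    rw [div_le_one hpos]
    exact_mod_cast hi
  exact ⟨⟨le_trans (by positivity) h1, h2.trans (hle i hi)⟩,
    ⟨le_trans (by positivity) h3, h4.trans (hle j hj)⟩⟩

theorem cell_sub {r : ℕ} (hr : 2 ≤ r) (k m i p : ℕ) (hp : p < r ^ m) {x : ℝ}
    (hx : x ∈ Set.Icc (((r ^ m * i + p : ℕ) : ℝ) / (r ^ (k + m) : ℕ))
      ((((r ^ m * i + p : ℕ) : ℝ) + 1) / (r ^ (k + m) : ℕ))) :
    x ∈ Set.Icc ((i : ℝ) / (r ^ k : ℕ)) (((i : ℝ) + 1) / (r ^ k : ℕ)) := by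
  have hk : (0 : ℝ) < (r ^ k : ℕ) := by positivity
  have hm : (0 : ℝ) < (r ^ m : ℕ) := by positivity
  have e : ((r ^ (k + m) : ℕ) : ℝ) = (r ^ k : ℕ) * (r ^ m : ℕ) := by rw [pow_add]; push_cast; ring
  have hp' : (p : ℝ) + 1 ≤ (r ^ m : ℕ) := by exact_mod_cast hp
  have hp0 : (0 : ℝ) ≤ p := by positivity
  rw [e, Nat.cast_add, Nat.cast_mul] at hx
  refine ⟨le_trans ?_ hx.1, hx.2.trans ?_⟩
  · rw [div_le_div_iff₀ hk (by positivity)]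
    nlinarith
  · rw [div_le_div_iff₀ (by positivity) hk]
    nlinarith

theorem pat_near {V C : Type} {r : ℕ} (hr : 2 ≤ r) {D : V → (Fin r × Fin r → V)} {𝔠 : V → C}
    {a : ℕ → ℕ → ℕ → V} {c₀ : C}
    (harec : ∀ (n i j : ℕ), i < r ^ n → j < r ^ n → ∀ s t : Fin r,
      a (n + 1) (r * i + s) (r * j + t) = D (a n i j) (s, t)) (k m m' : ℕ)
    (h : ∀ v, (∃ w, 𝔠 w = c₀ ∧ IsWalk (fun v w => ∃ s t : Fin r, D v (s, t) = w) m v w) →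
      ∃ w, 𝔠 w = c₀ ∧ IsWalk (fun v w => ∃ s t : Fin r, D v (s, t) = w) m' v w)
    (x : ℝ × ℝ) (hx : x ∈ pat r 𝔠 a c₀ (k + m)) :
    ∃ y ∈ pat r 𝔠 a c₀ (k + m'), dist x y ≤ 1 / (r : ℝ) ^ k := by
  obtain ⟨i', j', hi', hj', hc, hx1, hx2⟩ := mem_pat.1 hx
  have hpos : 0 < r ^ m := by positivity
  obtain ⟨i, p, hp, rfl⟩ : ∃ i p, p < r ^ m ∧ i' = r ^ m * i + p :=
    ⟨i' / r ^ m, i' % r ^ m, Nat.mod_lt _ hpos, (Nat.div_add_mod _ _).symm⟩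
  obtain ⟨j, q, hq, rfl⟩ : ∃ i p, p < r ^ m ∧ j' = r ^ m * i + p :=
    ⟨j' / r ^ m, j' % r ^ m, Nat.mod_lt _ hpos, (Nat.div_add_mod _ _).symm⟩
  have hlt : ∀ i p, r ^ m * i + p < r ^ (k + m) → i < r ^ k := by
    intro i p h
    rw [add_comm, pow_add] at h
    exact lt_of_mul_lt_mul_left (lt_of_le_of_lt (Nat.le_add_left _ p) (by linarith)) hpos.le
  have hi := hlt i p hi'
  have hj := hlt j q hj'
  obtain ⟨w, hw, hwalk⟩ := h _ ⟨_, hc, walk_of_cell hr harec m k i j p q hi hj hp hq⟩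
  obtain ⟨p', q', hp', hq', hpq⟩ := cell_of_walk hr harec m' k i j w hi hj hwalk
  have hlt2 : ∀ i p, i < r ^ k → p < r ^ m' → r ^ m' * i + p < r ^ (k + m') := by
    intro i p hi hp
    have : r ^ m' * (i + 1) ≤ r ^ m' * r ^ k := Nat.mul_le_mul_left _ hi
    rw [add_comm k, pow_add]; linarith
  have hmem : ∀ z : ℕ, (z : ℝ) / (r ^ (k + m') : ℕ) ∈
      Set.Icc ((z : ℝ) / (r ^ (k + m') : ℕ)) (((z : ℝ) + 1) / (r ^ (k + m') : ℕ)) := by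
    intro z
    refine ⟨le_rfl, ?_⟩
    gcongr
    linarith
  refine ⟨(((r ^ m' * i + p' : ℕ) : ℝ) / (r ^ (k + m') : ℕ),
    ((r ^ m' * j + q' : ℕ) : ℝ) / (r ^ (k + m') : ℕ)),
    mem_pat.2 ⟨_, _, hlt2 i p' hi hp', hlt2 j q' hj hq', by rw [hpq, hw], hmem _, hmem _⟩, ?_⟩
  have hd : ∀ (i : ℕ) {s t : ℝ}, s ∈ Set.Icc ((i : ℝ) / (r ^ k : ℕ)) (((i : ℝ) + 1) / (r ^ k : ℕ)) →
      t ∈ Set.Icc ((i : ℝ) / (r ^ k : ℕ)) (((i : ℝ) + 1) / (r ^ k : ℕ)) →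
      dist s t ≤ 1 / (r : ℝ) ^ k := by
    intro i s t hs ht
    refine (Real.dist_le_of_mem_Icc hs ht).trans (le_of_eq ?_)
    push_cast
    ring
  rw [Prod.dist_eq]
  exact max_le (hd i (cell_sub hr k m i p hp hx1) (cell_sub hr k m' i p' hp' (hmem _)))
    (hd j (cell_sub hr k m j q hq hx2) (cell_sub hr k m' j q' hq' (hmem _)))

/-- Let `D : V → (Fin r × Fin r → V)` be a matrix substitution system on a
finite alphabet `V` with `r ≥ 2`, `𝔠 : V → C` a coloring, and `a n` the arrays obtained by
iterated substitution starting from `v₀`.  If in the associated graph every vertex lying on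
a closed walk is aperiodic, then for each color the patterns converge in the extended
Hausdorff distance to a closed subset of `[0,1]²`. -/
theorem substitution_patterns_converge
    (V : Type) [Fintype V] (r : ℕ) (hr : 2 ≤ r)
    (D : V → (Fin r × Fin r → V))
    (C : Type) [Fintype C] (𝔠 : V → C)
    (v₀ : V)
    (a : ℕ → ℕ → ℕ → V)
    (ha0 : a 0 0 0 = v₀)
    (harec : ∀ (n i j : ℕ), i < r ^ n → j < r ^ n → ∀ s t : Fin r,
      a (n + 1) (r * i + s) (r * j + t) = D (a n i j) (s, t))
    (haper : ∀ v : V, (∃ n, 0 < n ∧ IsWalk (fun v w => ∃ s t : Fin r, D v (s, t) = w) n v v) →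
      ∀ d : ℕ, (∀ n, 0 < n → IsWalk (fun v w => ∃ s t : Fin r, D v (s, t) = w) n v v → d ∣ n) →
        d = 1) :
    ∀ c₀ : C, ∃ K : Set (ℝ × ℝ),
      IsClosed K ∧ K ⊆ Set.Icc (0 : ℝ) 1 ×ˢ Set.Icc (0 : ℝ) 1 ∧
      Tendsto
        (fun n : ℕ =>
          EMetric.hausdorffEdist
            (⋃ (i : ℕ) (j : ℕ) (_ : i < r ^ n) (_ : j < r ^ n) (_ : 𝔠 (a n i j) = c₀),
              Set.Icc ((i : ℝ) / (r ^ n : ℕ)) (((i : ℝ) + 1) / (r ^ n : ℕ)) ×ˢ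
              Set.Icc ((j : ℝ) / (r ^ n : ℕ)) (((j : ℝ) + 1) / (r ^ n : ℕ)))
            K)
        atTop (nhds 0) := by
  intro c₀
  obtain ⟨N, hN⟩ := uniform_color (fun w => 𝔠 w = c₀) haper
  let F : ℕ → TopologicalSpace.Closeds (ℝ × ℝ) := fun n => ⟨pat r 𝔠 a c₀ n, isClosed_pat⟩
  have hF : ∀ k, ∀ n ≥ k + N, ∀ n' ≥ k + N,
      edist (F n) (F n') ≤ ENNReal.ofReal (1 / (r : ℝ) ^ k) := by
    intro k n hn n' hn'
    obtain ⟨m, rfl⟩ := Nat.exists_eq_add_of_le (show k ≤ n by omega)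
    obtain ⟨m', rfl⟩ := Nat.exists_eq_add_of_le (show k ≤ n' by omega)
    rw [TopologicalSpace.Closeds.edist_eq]
    refine Metric.hausdorffEDist_le_of_mem_edist ?_ ?_
    · intro x hx
      obtain ⟨y, hy, hxy⟩ := pat_near hr harec k m m'
        (fun v => hN v m (by omega) m' (by omega)) x hx
      exact ⟨y, hy, by rw [edist_dist]; exact ENNReal.ofReal_le_ofReal hxy⟩
    · intro x hx
      obtain ⟨y, hy, hxy⟩ := pat_near hr harec k m' m
        (fun v => hN v m' (by omega) m (by omega)) x hx
      exact ⟨y, hy, by rw [edist_dist]; exact ENNReal.ofReal_le_ofReal hxy⟩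
  have hcauchy : CauchySeq F := by
    rw [EMetric.cauchySeq_iff]
    intro ε hε
    have hr1 : (1 : ℝ) < r := by exact_mod_cast hr
    have hlim : Tendsto (fun k : ℕ => ENNReal.ofReal (1 / (r : ℝ) ^ k)) atTop (nhds 0) := by
      have h1 : Tendsto (fun k : ℕ => 1 / (r : ℝ) ^ k) atTop (nhds 0) := by
        simp only [one_div]
        exact tendsto_inv_atTop_zero.comp (tendsto_pow_atTop_atTop_of_one_lt hr1)
      simpa using ENNReal.tendsto_ofReal h1
    obtain ⟨k, hk⟩ := (hlim.eventually (gt_mem_nhds hε)).exists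
    exact ⟨k + N, fun m hm n hn => (hF k m hm n hn).trans_lt hk⟩
  obtain ⟨K, hK⟩ := cauchySeq_tendsto_of_complete hcauchy
  have hK' : Tendsto (fun n => Metric.hausdorffEDist (pat r 𝔠 a c₀ n) (K : Set (ℝ × ℝ)))
      atTop (nhds 0) := by
    have := (tendsto_iff_edist_tendsto_0).1 hK
    exact this
  refine ⟨K, K.isClosed, ?_, hK'⟩
  intro x hx
  have hbox : IsClosed (Set.Icc (0 : ℝ) 1 ×ˢ Set.Icc (0 : ℝ) 1) := isClosed_Icc.prod isClosed_Icc
  rw [← hbox.closure_eq, Metric.mem_closure_iff_infEDist_zero]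
  refine le_antisymm (ge_of_tendsto' hK' fun n => ?_) bot_le
  calc _ ≤ Metric.infEDist x (pat r 𝔠 a c₀ n) := Metric.infEDist_anti (pat_subset hr)
    _ ≤ Metric.hausdorffEDist (K : Set (ℝ × ℝ)) (pat r 𝔠 a c₀ n) :=
      Metric.infEDist_le_hausdorffEDist_of_mem hx
    _ = _ := Metric.hausdorffEDist_comm
end

section
/- Let p be a prime, l a positive integer, and R a commutative ring in which p^l · 1 = 0. Then for all x, y ∈ R and all n ∈ ℕ: (x + y)^{p^{n+l−1}} = (x^{p^n} + y^{p^n})^{p^{l−1}}. -/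
/-- In a commutative ring `R` with `p ^ l = 0` (`p` prime, `l ≥ 1`),
for all `x y : R` and `n : ℕ` we have
`(x + y) ^ (p ^ (n + l - 1)) = (x ^ (p ^ n) + y ^ (p ^ n)) ^ (p ^ (l - 1))`. -/
theorem add_pow_char_pow_of_char_dvd
    (p : ℕ) (hp : p.Prime) (l : ℕ) (hl : 0 < l)
    (R : Type) [CommRing R] (hchar : ((p ^ l : ℕ) : R) = 0) :
    ∀ (x y : R) (n : ℕ),
      (x + y) ^ p ^ (n + l - 1) = (x ^ p ^ n + y ^ p ^ n) ^ p ^ (l - 1) := by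
  intro x y n
  obtain ⟨k, rfl⟩ : ∃ k, l = k + 1 := ⟨l - 1, by omega⟩
  obtain ⟨r, hr⟩ := exists_add_pow_prime_pow_eq hp x y n
  have h : (p : R) ∣ (x + y) ^ p ^ n - (x ^ p ^ n + y ^ p ^ n) :=
    ⟨x * y * r, by rw [hr]; ring⟩
  have h2 := dvd_sub_pow_of_dvd_sub h k
  have h0 : (p : R) ^ (k + 1) = 0 := by rw [← hchar]; push_cast; rfl
  rw [h0, zero_dvd_iff, sub_eq_zero, ← pow_mul, ← pow_add] at h2
  exact h2
end

section
/- Let R be a commutative ring in which 2 · 1 = 0, and let T be an invertible 2 × 2 matrix over R. Set T̃ = (det T) • T⁻¹ (the dual of T). Then for every n ∈ ℕ: T^{2^n} = T̃^{2^n} + (tr T)^{2^n} • I, where I is the identity matrix; consequently tr(T^{2^n}) = tr(T̃^{2^n}). -/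
/-- Let `R` be a commutative ring of characteristic 2 and `T` an
invertible `2 × 2` matrix over `R`.  With `T̃ = det T • T⁻¹`, for every `n` we have
`T ^ (2 ^ n) = T̃ ^ (2 ^ n) + (tr T) ^ (2 ^ n) • 1`, and consequently
`tr (T ^ (2 ^ n)) = tr (T̃ ^ (2 ^ n))`. -/
theorem dual_pow_two_pow
    (R : Type) [CommRing R] (hchar : (2 : R) = 0)
    (T : Matrix (Fin 2) (Fin 2) R) (hT : IsUnit T.det) :
    ∀ n : ℕ,
      T ^ 2 ^ n =
          (T.det • T⁻¹) ^ 2 ^ n + T.trace ^ 2 ^ n • (1 : Matrix (Fin 2) (Fin 2) R) ∧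
        (T ^ 2 ^ n).trace = ((T.det • T⁻¹) ^ 2 ^ n).trace := by
  have hadj : T.det • T⁻¹ = T.adjugate := by
    rw [Matrix.inv_def, smul_smul, Ring.mul_inverse_cancel _ hT, one_smul]
  rw [hadj]
  have key : ∀ n : ℕ, T ^ 2 ^ n =
      T.adjugate ^ 2 ^ n + T.trace ^ 2 ^ n • (1 : Matrix (Fin 2) (Fin 2) R) := by
    intro n
    induction n with
    | zero =>
      ext i j
      fin_cases i <;> fin_cases j <;>
        simp [Matrix.adjugate_fin_two, Matrix.trace_fin_two]
      · linear_combination (-T 1 1) * hchar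
      · linear_combination (T 0 1) * hchar
      · linear_combination (T 1 0) * hchar
      · linear_combination (-T 0 0) * hchar
    | succ k ih =>
      have h2 : ∀ B : Matrix (Fin 2) (Fin 2) R, B + B = 0 := by
        intro B
        ext i j
        simp only [Matrix.add_apply, Matrix.zero_apply]
        linear_combination (B i j) * hchar
      rw [pow_succ, pow_mul, pow_mul, pow_mul, ih, sq, add_mul, mul_add, mul_add, sq, sq]
      simp only [smul_mul_assoc, mul_smul_comm, one_mul, mul_one, smul_smul]
      rw [add_assoc, ← add_assoc (T.trace ^ 2 ^ k • T.adjugate ^ 2 ^ k), h2, zero_add]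
  intro n
  refine ⟨key n, ?_⟩
  rw [key n, Matrix.trace_add, Matrix.trace_smul, Matrix.trace_one]
  simp [hchar]
end

section
/- Let Γ be a directed graph on a finite vertex set V in which every vertex lying on a closed walk is aperiodic, i.e., for every vertex w admitting a closed walk, the gcd of the set {n ≥ 1 : there is a closed walk of length n at w} is 1. Then for every vertex v and every subset S ⊆ V, the set X = {n ∈ ℕ : there is a walk of length n from v to some vertex of S} is either finite or cofinite in ℕ. -/
theorem IsWalk.append {V : Type} {E : V → V → Prop} {m n : ℕ} {u v w : V}
    (h1 : IsWalk E m u v) (h2 : IsWalk E n v w) : IsWalk E (m + n) u w := by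
  induction m generalizing u with
  | zero =>
    have h : u = v := h1
    subst h
    rwa [Nat.zero_add]
  | succ k ih =>
    obtain ⟨x, hx, hw⟩ := h1
    rw [Nat.add_right_comm]
    exact ⟨x, hx, ih hw⟩

/-- A walk is traced out by a vertex sequence, all of whose segments are walks. -/
theorem IsWalk.exists_seq {V : Type} {E : V → V → Prop} {n : ℕ} {v w : V}
    (h : IsWalk E n v w) : ∃ f : ℕ → V, f 0 = v ∧ f n = w ∧
      ∀ i j, i + j ≤ n → IsWalk E j (f i) (f (i + j)) := by
  induction n generalizing v with
  | zero =>
    have h' : v = w := h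
    refine ⟨fun _ => v, rfl, h', fun i j hij => ?_⟩
    obtain rfl : j = 0 := by omega
    exact rfl
  | succ k ih =>
    obtain ⟨x, hx, hw⟩ := h
    obtain ⟨f, hf0, hfn, hf⟩ := ih hw
    refine ⟨fun i => Nat.casesOn i v f, rfl, hfn, fun i j hij => ?_⟩
    cases i with
    | zero =>
      cases j with
      | zero => exact rfl
      | succ j =>
        have h1 := hf 0 j (by omega)
        rw [Nat.zero_add] at h1 ⊢
        refine ⟨x, hx, ?_⟩
        rw [hf0] at h1
        exact h1
    | succ i =>
      have h1 := hf i j (by omega)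
      rw [Nat.add_right_comm]
      exact h1

/-- All sufficiently large numbers are closed-walk lengths at an aperiodic vertex. -/
theorem IsWalk.eventually_closed {V : Type} {E : V → V → Prop} {w : V}
    (h : ∀ d : ℕ, (∀ n, 0 < n → IsWalk E n w w → d ∣ n) → d = 1) :
    ∃ N, ∀ m ≥ N, IsWalk E m w w := by
  obtain ⟨N, hN⟩ := Nat.exists_mem_closure_of_ge {n | 0 < n ∧ IsWalk E n w w}
  have h1 := h (Nat.setGcd {n | 0 < n ∧ IsWalk E n w w})
    (fun n hn hw => Nat.setGcd_dvd_of_mem ⟨hn, hw⟩)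
  refine ⟨N, fun m hm => ?_⟩
  have h2 := hN m hm (h1 ▸ one_dvd m)
  exact AddSubmonoid.closure_induction (motive := fun k _ => IsWalk E k w w)
    (fun _ hx => hx.2) rfl (fun _ _ _ _ hx hy => hx.append hy) h2

/-- In a directed graph on a finite vertex set in which every vertex
lying on a closed walk is aperiodic, for every vertex `v` and every set `S` of vertices,
the set of lengths of walks from `v` into `S` is finite or cofinite. -/
theorem reachability_lengths_finite_or_cofinite
    (V : Type) [Fintype V] (E : V → V → Prop)
    (haper : ∀ w : V, (∃ n, 0 < n ∧ IsWalk E n w w) →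
      ∀ d : ℕ, (∀ n, 0 < n → IsWalk E n w w → d ∣ n) → d = 1)
    (v : V) (S : Set V) :
    ({n : ℕ | ∃ w ∈ S, IsWalk E n v w}).Finite ∨
      ({n : ℕ | ∃ w ∈ S, IsWalk E n v w}ᶜ).Finite := by
  by_cases hfin : ({n : ℕ | ∃ w ∈ S, IsWalk E n v w}).Finite
  · exact Or.inl hfin
  right
  obtain ⟨n, ⟨w, hwS, hw⟩, hn⟩ := Set.Infinite.exists_gt hfin (Fintype.card V)
  obtain ⟨f, hf0, hfn, hf⟩ := hw.exists_seq
  obtain ⟨i, j, hij, hfij⟩ : ∃ i j : Fin (n + 1), i < j ∧ f i = f j := by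
    obtain ⟨i, j, hne, he⟩ := Fintype.exists_ne_map_eq_of_card_lt
      (fun i : Fin (n + 1) => f i) (by simp; omega)
    rcases lt_or_gt_of_ne hne with h | h
    · exact ⟨i, j, h, he⟩
    · exact ⟨j, i, h, he.symm⟩
  have hij' : (i : ℕ) < j := hij
  have hj := j.isLt
  have hpre := hf 0 i (by omega)
  have hcyc := hf i (j - i) (by omega)
  have hpost := hf i (n - i) (by omega)
  rw [Nat.zero_add, hf0] at hpre
  rw [show (i : ℕ) + (j - i) = j by omega, ← hfij] at hcyc
  rw [show (i : ℕ) + (n - i) = n by omega, hfn] at hpost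
  obtain ⟨N, hN⟩ := IsWalk.eventually_closed (haper (f i) ⟨_, by omega, hcyc⟩)
  refine (Set.finite_lt_nat (N + n)).subset fun m hm => ?_
  by_contra hlt
  have hlt' : N + n ≤ m := not_lt.mp hlt
  refine hm ⟨w, hwS, ?_⟩
  have := (hpre.append (hN (m - n) (by omega))).append hpost
  rwa [show (i : ℕ) + (m - n) + (n - i) = m by omega] at this
end
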